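/- Soundness of the SOS relaxation for the JSR (relaxation (5) of the paper). Let A₁, …, A_ℓ : Matrix (Fin n) (Fin n) ℝ, let d ≥ 1, and let γ > 0. Suppose p is a multivariate real polynomial in n variables, homogeneous of degree 2d, with p(x) > 0 for all x ≠ 0, and suppose that for every i ∈ {1, …, ℓ} the polynomial x ↦ γ^{2d} · p(x) − p(A_i.mulVec x) is a sum of squares of polynomials (i.e., equals ∑_t q_t² for finitely many polynomials q_t). Then ρ(A₁,…,A_ℓ) ≤ γ, where ρ is the joint spectral radius limsup_{k→∞} max_{α ∈ {1,…,ℓ}^k} ‖A_{α_k} ⋯ A_{α_1}‖^{1/k} computed with the Frobenius norm. -/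

import Mathlib

/-- Frobenius norm of a real `n × n` matrix. -/
noncomputable def frob {n : ℕ} (A : Matrix (Fin n) (Fin n) ℝ) : ℝ :=
  Real.sqrt (∑ i, ∑ j, (A i j) ^ 2)

/-- Ordered product `A (α (ℓ-1)) * ⋯ * A (α 1) * A (α 0)` along the first `ℓ`
letters of the infinite word `α`. -/
noncomputable def wordProd {Γ : Type*} {n : ℕ} (A : Γ → Matrix (Fin n) (Fin n) ℝ)
    (α : ℕ → Γ) : ℕ → Matrix (Fin n) (Fin n) ℝ
  | 0 => 1
  | ℓ + 1 => A (α ℓ) * wordProd A α ℓ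

/-- Joint spectral radius of the finite family `A₁, …, A_ℓ`:
`limsup_{k→∞} max_{α ∈ {1,…,ℓ}^k} ‖A_{α_k} ⋯ A_{α_1}‖^{1/k}` (Frobenius
norm). -/
noncomputable def jsr {ℓ n : ℕ} (A : Fin ℓ → Matrix (Fin n) (Fin n) ℝ) : ℝ :=
  Filter.limsup
    (fun k : ℕ =>
      sSup {r : ℝ | ∃ α : ℕ → Fin ℓ, r = frob (wordProd A α k) ^ ((1 : ℝ) / (k : ℝ))})
    Filter.atTop

/-- The polynomial `x ↦ p (Aᵢ x)`: substitute `X j ↦ ∑ k, (Aᵢ)_{j k} • X k`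
into `p`. -/
noncomputable def polyCompMat {n : ℕ} (M : Matrix (Fin n) (Fin n) ℝ)
    (p : MvPolynomial (Fin n) ℝ) : MvPolynomial (Fin n) ℝ :=
  MvPolynomial.bind₁ (fun j => ∑ k, MvPolynomial.C (M j k) * MvPolynomial.X k) p

open Filter Topology

theorem eval_polyCompMat {n : ℕ} (M : Matrix (Fin n) (Fin n) ℝ)
    (p : MvPolynomial (Fin n) ℝ) (x : Fin n → ℝ) :
    MvPolynomial.eval x (polyCompMat M p) = MvPolynomial.eval (M.mulVec x) p := by
  have h := MvPolynomial.eval₂Hom_bind₁ (RingHom.id ℝ) x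
    (fun j => ∑ k, MvPolynomial.C (M j k) * MvPolynomial.X k) p
  refine h.trans ?_
  change MvPolynomial.eval _ p = _
  congr 2
  ext j
  simp [Matrix.mulVec, dotProduct]

theorem eval_smul_of_isHomogeneous {n m : ℕ} {p : MvPolynomial (Fin n) ℝ}
    (hp : p.IsHomogeneous m) (c : ℝ) (x : Fin n → ℝ) :
    MvPolynomial.eval (c • x) p = c ^ m * MvPolynomial.eval x p := by
  rw [MvPolynomial.eval_eq', MvPolynomial.eval_eq', Finset.mul_sum]
  refine Finset.sum_congr rfl fun e he => ?_
  have hdeg : ∑ i, e i = m := by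
    rw [← hp (MvPolynomial.mem_support_iff.mp he), Finsupp.weight_apply,
      Finsupp.sum_fintype _ _ (by simp)]
    simp
  simp only [Pi.smul_apply, smul_eq_mul, mul_pow, Finset.prod_mul_distrib,
    Finset.prod_pow_eq_pow_sum, hdeg]
  ring

/-- A homogeneous polynomial that is positive away from the origin dominates a positive multiple
of the corresponding power of the norm. -/
theorem exists_pos_mul_norm_pow_le_eval {n m : ℕ} (hn : 1 ≤ n) {p : MvPolynomial (Fin n) ℝ}
    (hp : p.IsHomogeneous m) (hm : m ≠ 0)
    (hpos : ∀ x : Fin n → ℝ, x ≠ 0 → 0 < MvPolynomial.eval x p) :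
    ∃ c : ℝ, 0 < c ∧ ∀ x : Fin n → ℝ, c * ‖x‖ ^ m ≤ MvPolynomial.eval x p := by
  have : Nonempty (Fin n) := ⟨⟨0, hn⟩⟩
  obtain ⟨y, hy, hmin⟩ := (isCompact_sphere (0 : Fin n → ℝ) 1).exists_isMinOn
    (NormedSpace.sphere_nonempty.mpr zero_le_one) (MvPolynomial.continuous_eval p).continuousOn
  refine ⟨_, hpos y (ne_zero_of_mem_unit_sphere ⟨y, hy⟩), fun x => ?_⟩
  rcases eq_or_ne x 0 with rfl | hx
  · have h := eval_smul_of_isHomogeneous hp 0 (0 : Fin n → ℝ)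
    rw [smul_zero, zero_pow hm, zero_mul] at h
    rw [h]
    simp [zero_pow hm]
  · have hx' : ‖x‖ ≠ 0 := norm_ne_zero_iff.mpr hx
    have hle : MvPolynomial.eval y p ≤ MvPolynomial.eval (‖x‖⁻¹ • x) p :=
      hmin (by simp [norm_smul, hx'])
    calc MvPolynomial.eval y p * ‖x‖ ^ m
        ≤ MvPolynomial.eval (‖x‖⁻¹ • x) p * ‖x‖ ^ m := by gcongr
      _ = MvPolynomial.eval x p := by
        rw [mul_comm, ← eval_smul_of_isHomogeneous hp, smul_inv_smul₀ hx']

theorem eval_wordProd_mulVec_le {Γ : Type*} {n : ℕ} {A : Γ → Matrix (Fin n) (Fin n) ℝ}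
    {p : MvPolynomial (Fin n) ℝ} {b : ℝ} (hb : 0 ≤ b)
    (h : ∀ i x, MvPolynomial.eval ((A i).mulVec x) p ≤ b * MvPolynomial.eval x p)
    (α : ℕ → Γ) (x : Fin n → ℝ) (k : ℕ) :
    MvPolynomial.eval ((wordProd A α k).mulVec x) p ≤ b ^ k * MvPolynomial.eval x p := by
  induction k with
  | zero => simp [wordProd]
  | succ k ih =>
    rw [wordProd, ← Matrix.mulVec_mulVec, pow_succ', mul_assoc]
    exact (h _ _).trans (mul_le_mul_of_nonneg_left ih hb)

theorem frob_nonneg {n : ℕ} (A : Matrix (Fin n) (Fin n) ℝ) : 0 ≤ frob A :=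
  Real.sqrt_nonneg _

theorem frob_le_of_abs_le {n : ℕ} {A : Matrix (Fin n) (Fin n) ℝ} {b : ℝ} (hb : 0 ≤ b)
    (h : ∀ i j, |A i j| ≤ b) : frob A ≤ n * b := by
  refine Real.sqrt_le_iff.mpr ⟨by positivity, ?_⟩
  calc ∑ i, ∑ j, (A i j) ^ 2 ≤ ∑ _i : Fin n, ∑ _j : Fin n, b ^ 2 :=
        Finset.sum_le_sum fun i _ => Finset.sum_le_sum fun j _ =>
          sq_le_sq.mpr ((h i j).trans (le_abs_self b))
    _ = (n * b) ^ 2 := by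
        simp
        ring

/-- If all products of length `k` have Frobenius norm at most `C * γ ^ k`, then the joint spectral
radius is at most `γ`. -/
theorem jsr_le_of_frob_wordProd_le {ℓ n : ℕ} {A : Fin ℓ → Matrix (Fin n) (Fin n) ℝ} {C γ : ℝ}
    (hC : 0 < C) (hγ : 0 ≤ γ) (h : ∀ α k, frob (wordProd A α k) ≤ C * γ ^ k) : jsr A ≤ γ := by
  have hlim : Tendsto (fun k : ℕ => C ^ ((1 : ℝ) / k) * γ) atTop (𝓝 γ) := by
    have h0 : Tendsto (fun k : ℕ => C ^ ((1 : ℝ) / k)) atTop (𝓝 (C ^ (0 : ℝ))) :=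
      (Real.continuousAt_const_rpow hC.ne').tendsto.comp tendsto_one_div_atTop_nhds_zero_nat
    simpa using h0.mul_const γ
  rw [← hlim.limsup_eq]
  refine limsup_le_limsup ?_ ?_ hlim.isBoundedUnder_le
  · filter_upwards [eventually_ne_atTop 0] with k hk
    refine Real.sSup_le ?_ (by positivity)
    rintro r ⟨α, rfl⟩
    calc frob (wordProd A α k) ^ ((1 : ℝ) / k)
        ≤ (C * γ ^ k) ^ ((1 : ℝ) / k) :=
          Real.rpow_le_rpow (frob_nonneg _) (h α k) (by positivity)
      _ = C ^ ((1 : ℝ) / k) * γ := by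
          rw [Real.mul_rpow hC.le (by positivity), one_div, Real.pow_rpow_inv_natCast hγ hk]
  · refine (isBoundedUnder_of ⟨0, fun k => ?_⟩ : IsBoundedUnder (· ≥ ·) _ _).isCoboundedUnder_le
    refine Real.sSup_nonneg ?_
    rintro r ⟨α, rfl⟩
    exact Real.rpow_nonneg (frob_nonneg _) _

/-- **Soundness of the SOS relaxation for the JSR.** If `p` is homogeneous of
degree `2d`, strictly positive away from the origin, and for every `i` the
polynomial `γ^{2d} p(x) - p(Aᵢ x)` is a sum of squares of polynomials, then
`ρ(A₁, …, A_ℓ) ≤ γ`. -/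
theorem jsr_le_of_sos {n ℓ d : ℕ} (hn : 1 ≤ n) (hℓ : 1 ≤ ℓ) (hd : 1 ≤ d)
    (A : Fin ℓ → Matrix (Fin n) (Fin n) ℝ) (γ : ℝ) (hγ : 0 < γ)
    (p : MvPolynomial (Fin n) ℝ) (hhom : p.IsHomogeneous (2 * d))
    (hpos : ∀ x : Fin n → ℝ, x ≠ 0 → 0 < MvPolynomial.eval x p)
    (hsos : ∀ i : Fin ℓ, ∃ (t : ℕ) (q : Fin t → MvPolynomial (Fin n) ℝ),
      MvPolynomial.C (γ ^ (2 * d)) * p - polyCompMat (A i) p = ∑ s, (q s) ^ 2) :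
    jsr A ≤ γ := by
  have hstep : ∀ i x, MvPolynomial.eval ((A i).mulVec x) p
      ≤ γ ^ (2 * d) * MvPolynomial.eval x p := by
    intro i x
    obtain ⟨t, q, hq⟩ := hsos i
    have h := congrArg (MvPolynomial.eval x) hq
    simp only [map_sub, map_mul, map_sum, map_pow, MvPolynomial.eval_C, eval_polyCompMat] at h
    have h' : 0 ≤ ∑ s, (MvPolynomial.eval x (q s)) ^ 2 :=
      Finset.sum_nonneg fun s _ => sq_nonneg _
    linarith
  obtain ⟨c, hc, hlow⟩ := exists_pos_mul_norm_pow_le_eval hn hhom (by lia) hpos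
  have hbasis : ∀ j : Fin n, 0 ≤ MvPolynomial.eval (Pi.single j (1 : ℝ)) p := fun j =>
    (mul_nonneg hc.le (by positivity)).trans (hlow _)
  set M := ∑ j : Fin n, MvPolynomial.eval (Pi.single j (1 : ℝ)) p with hM
  have hM0 : 0 ≤ M := Finset.sum_nonneg fun j _ => hbasis j
  set C := 1 + M / c with hCdef
  have hC1 : 1 ≤ C := le_add_of_nonneg_right (by positivity)
  have hMC : M ≤ c * C ^ (2 * d) := by
    have h1 : C ≤ C ^ (2 * d) := le_self_pow₀ hC1 (by lia)
    have h2 : c * C = c + M := by rw [hCdef]; field_simp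
    nlinarith
  have hentry : ∀ α k i j, |wordProd A α k i j| ≤ C * γ ^ k := by
    intro α k i j
    have hcol : (wordProd A α k).mulVec (Pi.single j 1) i = wordProd A α k i j := by simp
    have hnorm : ‖(wordProd A α k).mulVec (Pi.single j 1)‖ ≤ C * γ ^ k := by
      refine le_of_pow_le_pow_left₀ (n := 2 * d) (by lia) (by positivity) ?_
      refine le_of_mul_le_mul_left ?_ hc
      calc c * ‖(wordProd A α k).mulVec (Pi.single j 1)‖ ^ (2 * d)
          ≤ MvPolynomial.eval ((wordProd A α k).mulVec (Pi.single j 1)) p := hlow _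
        _ ≤ (γ ^ (2 * d)) ^ k * MvPolynomial.eval (Pi.single j 1) p :=
            eval_wordProd_mulVec_le (by positivity) hstep α _ k
        _ ≤ (γ ^ (2 * d)) ^ k * (c * C ^ (2 * d)) := by
            gcongr
            exact (Finset.single_le_sum (fun j _ => hbasis j) (Finset.mem_univ j)).trans hMC
        _ = c * (C * γ ^ k) ^ (2 * d) := by
            rw [mul_pow, pow_right_comm]
            ring
    rw [← hcol]
    exact (norm_le_pi_norm _ i).trans hnorm
  have hn0 : (0 : ℝ) < n := by exact_mod_cast hn
  refine jsr_le_of_frob_wordProd_le (C := n * C) (by positivity) hγ.le fun α k => ?_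
  rw [mul_assoc]
  exact frob_le_of_abs_le (by positivity) (hentry α k)
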